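/- arXiv:1105.5372 — 7 statements merged into one kernel-verified Lean document; each statement's English description precedes it below -/
import Mathlib

section
/- Let U be an N×K real matrix, Ã a K×K real matrix, V an N×K real matrix, and D an invertible N×N real matrix. Assume VᵀD⁻¹U is invertible, and set D̂ = (VᵀD⁻¹U)⁻¹. Assume further that Ã + D̂ is invertible. Then the matrix A = U * Ã * Vᵀ + D is invertible, and (U * Ã * Vᵀ + D) * (D⁻¹ * U * D̂ * (Ã + D̂)⁻¹ * D̂ * Vᵀ * D⁻¹ + D⁻¹ − D⁻¹ * U * D̂ * Vᵀ * D⁻¹) = I, the N×N identity matrix. -/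
open Matrix

/-- Strengthened Lemma 3.1: under the invertibility assumptions on `D`, `Vᵀ * D⁻¹ * U`
and `tA + D̂`, the matrix `A = U * tA * Vᵀ + D` is itself invertible, and the
Woodbury-type expression is an explicit right inverse. -/
theorem stmt_1 (N K : ℕ)
    (U V : Matrix (Fin N) (Fin K) ℝ)
    (tA : Matrix (Fin K) (Fin K) ℝ)
    (D : Matrix (Fin N) (Fin N) ℝ)
    (hD : IsUnit D.det)
    (hVDU : IsUnit (Vᵀ * D⁻¹ * U).det)
    (hsum : IsUnit (tA + (Vᵀ * D⁻¹ * U)⁻¹).det) :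
    IsUnit (U * tA * Vᵀ + D).det ∧
      (U * tA * Vᵀ + D) *
        (D⁻¹ * U * (Vᵀ * D⁻¹ * U)⁻¹ * (tA + (Vᵀ * D⁻¹ * U)⁻¹)⁻¹ *
            (Vᵀ * D⁻¹ * U)⁻¹ * Vᵀ * D⁻¹ +
          D⁻¹ -
          D⁻¹ * U * (Vᵀ * D⁻¹ * U)⁻¹ * Vᵀ * D⁻¹) = 1 := by
  have hmul : (U * tA * Vᵀ + D) *
        (D⁻¹ * U * (Vᵀ * D⁻¹ * U)⁻¹ * (tA + (Vᵀ * D⁻¹ * U)⁻¹)⁻¹ *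
            (Vᵀ * D⁻¹ * U)⁻¹ * Vᵀ * D⁻¹ +
          D⁻¹ -
          D⁻¹ * U * (Vᵀ * D⁻¹ * U)⁻¹ * Vᵀ * D⁻¹) = 1 := by
    have hW := mul_nonsing_inv _ hVDU
    have hS := mul_nonsing_inv _ hsum
    generalize (tA + (Vᵀ * D⁻¹ * U)⁻¹)⁻¹ = S at hS ⊢
    generalize (Vᵀ * D⁻¹ * U)⁻¹ = H at hW hS ⊢
    have hWX (X : Matrix (Fin K) (Fin N) ℝ) : Vᵀ * (D⁻¹ * (U * (H * X))) = X := by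
      simpa only [Matrix.mul_assoc, Matrix.one_mul] using congrArg (· * X) hW
    have hSX (X : Matrix (Fin K) (Fin N) ℝ) : U * (tA * (S * X)) + U * (H * (S * X)) = U * X := by
      simpa only [Matrix.mul_assoc, Matrix.add_mul, Matrix.mul_add, Matrix.one_mul] using
        congrArg (fun Y => U * (Y * X)) hS
    have hDX (X : Matrix (Fin N) (Fin N) ℝ) : D * (D⁻¹ * X) = X :=
      mul_nonsing_inv_cancel_left _ _ hD
    simp only [Matrix.mul_assoc, Matrix.add_mul, Matrix.mul_add, Matrix.mul_sub, hWX, hDX,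
      mul_nonsing_inv _ hD]
    rw [← hSX (H * (Vᵀ * D⁻¹))]
    abel
  exact ⟨isUnit_det_of_right_inverse hmul, hmul⟩
end

section
/- Let U be an N×K real matrix, Ã a K×K real matrix, V an N×K real matrix, and D an invertible N×N real matrix with VᵀD⁻¹U invertible; set D̂ = (VᵀD⁻¹U)⁻¹. Suppose vectors q and u in ℝᴺ satisfy (U * Ã * Vᵀ + D) q = u, and set q̂ = Vᵀ q ∈ ℝᴷ. Then (D̂ + Ã) q̂ = D̂ * Vᵀ * D⁻¹ * u. -/
open Matrix

/-- Equation (3.14) in the proof of Lemma 3.1: if `(U * tA * Vᵀ + D) q = u` and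
`q̂ = Vᵀ q`, then `(D̂ + tA) q̂ = D̂ * Vᵀ * D⁻¹ * u` where `D̂ = (Vᵀ * D⁻¹ * U)⁻¹`. -/
theorem stmt_2 (N K : ℕ)
    (U V : Matrix (Fin N) (Fin K) ℝ)
    (tA : Matrix (Fin K) (Fin K) ℝ)
    (D : Matrix (Fin N) (Fin N) ℝ)
    (hD : IsUnit D.det)
    (hVDU : IsUnit (Vᵀ * D⁻¹ * U).det)
    (q u : Fin N → ℝ)
    (hq : (U * tA * Vᵀ + D).mulVec q = u) :
    ((Vᵀ * D⁻¹ * U)⁻¹ + tA).mulVec (Vᵀ.mulVec q) =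
      ((Vᵀ * D⁻¹ * U)⁻¹ * Vᵀ * D⁻¹).mulVec u := by
  rw [← hq, mulVec_mulVec, mulVec_mulVec]
  congr 1
  have h : (Vᵀ * D⁻¹ * U)⁻¹ * (Vᵀ * D⁻¹ * U) = 1 := nonsing_inv_mul _ hVDU
  calc ((Vᵀ * D⁻¹ * U)⁻¹ + tA) * Vᵀ
      = (Vᵀ * D⁻¹ * U)⁻¹ * (Vᵀ * D⁻¹ * U) * (tA * Vᵀ) +
          (Vᵀ * D⁻¹ * U)⁻¹ * Vᵀ * (D⁻¹ * D) := by
        rw [h, nonsing_inv_mul _ hD, Matrix.one_mul, Matrix.mul_one, Matrix.add_mul, add_comm]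
    _ = (Vᵀ * D⁻¹ * U)⁻¹ * Vᵀ * D⁻¹ * (U * tA * Vᵀ + D) := by
        simp only [Matrix.mul_add, Matrix.mul_assoc]
end

section
/- Let U be an N×K real matrix, Ã a K×K real matrix, V an N×K real matrix, and D an invertible N×N real matrix with VᵀD⁻¹U invertible; set D̂ = (VᵀD⁻¹U)⁻¹, E = D⁻¹ * U * D̂, and G = D⁻¹ − D⁻¹ * U * D̂ * Vᵀ * D⁻¹. Suppose vectors q and u in ℝᴺ satisfy (U * Ã * Vᵀ + D) q = u, and set q̂ = Vᵀ q ∈ ℝᴷ. Then q = E * q̂ + G * u. -/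
open Matrix

/-- Equation (3.17) in the proof of Lemma 3.1: if `(U * tA * Vᵀ + D) q = u` and
`q̂ = Vᵀ q`, then `q = E q̂ + G u`, where `D̂ = (Vᵀ * D⁻¹ * U)⁻¹`, `E = D⁻¹ * U * D̂`
and `G = D⁻¹ - D⁻¹ * U * D̂ * Vᵀ * D⁻¹`. -/
theorem stmt_3 (N K : ℕ)
    (U V : Matrix (Fin N) (Fin K) ℝ)
    (tA : Matrix (Fin K) (Fin K) ℝ)
    (D : Matrix (Fin N) (Fin N) ℝ)
    (hD : IsUnit D.det)
    (hVDU : IsUnit (Vᵀ * D⁻¹ * U).det)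
    (q u : Fin N → ℝ)
    (hq : (U * tA * Vᵀ + D).mulVec q = u) :
    q = (D⁻¹ * U * (Vᵀ * D⁻¹ * U)⁻¹).mulVec (Vᵀ.mulVec q) +
        (D⁻¹ - D⁻¹ * U * (Vᵀ * D⁻¹ * U)⁻¹ * Vᵀ * D⁻¹).mulVec u := by
  have hX : D⁻¹ * D = 1 := nonsing_inv_mul D hD
  have hS : (Vᵀ * D⁻¹ * U)⁻¹ * (Vᵀ * D⁻¹ * U) = 1 := nonsing_inv_mul _ hVDU
  generalize (Vᵀ * D⁻¹ * U)⁻¹ = S at hS ⊢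
  generalize D⁻¹ = X at hX hS ⊢
  have hGU : (X - X * U * S * Vᵀ * X) * U = 0 := by
    rw [show (X - X * U * S * Vᵀ * X) * U = X * U - X * U * (S * (Vᵀ * X * U)) by
      simp only [Matrix.sub_mul, Matrix.mul_assoc], hS, Matrix.mul_one, sub_self]
  have hGD : (X - X * U * S * Vᵀ * X) * D = 1 - X * U * S * Vᵀ := by
    rw [Matrix.sub_mul, Matrix.mul_assoc _ X D, hX, Matrix.mul_one]
  rw [← hq, mulVec_mulVec, mulVec_mulVec, ← add_mulVec, Matrix.mul_add, hGD,
    Matrix.mul_assoc U, ← Matrix.mul_assoc _ U, hGU, Matrix.zero_mul, zero_add,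
    add_sub_cancel, one_mulVec]
end

section
/- Let D be an N×N symmetric invertible real matrix, U an N×K real matrix such that UᵀD⁻¹U is invertible, and Ã a K×K real matrix. Let A = U * Ã * Uᵀ + D, and define D̂ = (UᵀD⁻¹U)⁻¹ and E = D⁻¹ * U * D̂. Then Ã + D̂ = Eᵀ * A * E. -/
open Matrix

/-- The key congruence identity in the proof of Corollary 3.2: with `A = U * tA * Uᵀ + D`,
`D̂ = (Uᵀ * D⁻¹ * U)⁻¹` and `E = D⁻¹ * U * D̂`, one has `tA + D̂ = Eᵀ * A * E`. -/
theorem stmt_6 (N K : ℕ)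
    (D : Matrix (Fin N) (Fin N) ℝ)
    (hDsymm : Dᵀ = D)
    (hD : IsUnit D.det)
    (U : Matrix (Fin N) (Fin K) ℝ)
    (hUDU : IsUnit (Uᵀ * D⁻¹ * U).det)
    (tA : Matrix (Fin K) (Fin K) ℝ) :
    tA + (Uᵀ * D⁻¹ * U)⁻¹ =
      (D⁻¹ * U * (Uᵀ * D⁻¹ * U)⁻¹)ᵀ * (U * tA * Uᵀ + D) *
        (D⁻¹ * U * (Uᵀ * D⁻¹ * U)⁻¹) := by
  set S := Uᵀ * D⁻¹ * U with hS
  set E := D⁻¹ * U * S⁻¹ with hE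
  have hUE : Uᵀ * E = 1 := by
    rw [hE, ← Matrix.mul_assoc, ← Matrix.mul_assoc, ← hS, Matrix.mul_nonsing_inv _ hUDU]
  have hEU : Eᵀ * U = 1 := by
    simpa using congrArg Matrix.transpose hUE
  have hDE : D * E = U * S⁻¹ := by
    rw [hE, Matrix.mul_assoc, Matrix.mul_nonsing_inv_cancel_left _ _ hD]
  calc tA + S⁻¹ = (Eᵀ * U) * tA * (Uᵀ * E) + (Eᵀ * U) * S⁻¹ := by simp [hUE, hEU]
    _ = Eᵀ * (U * tA * Uᵀ) * E + Eᵀ * (D * E) := by rw [hDE]; simp only [Matrix.mul_assoc]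
    _ = Eᵀ * (U * tA * Uᵀ + D) * E := by
      rw [Matrix.mul_add, Matrix.add_mul, Matrix.mul_assoc Eᵀ D E]
end

section
/- Let A be an N×N symmetric positive definite real matrix admitting a factorization A = U * Ã * Uᵀ + D, where U is an N×K real matrix with trivial kernel (Ux = 0 implies x = 0), Ã is a K×K real matrix, and D is an N×N symmetric positive definite real matrix. Then the K×K matrix Ã + (UᵀD⁻¹U)⁻¹ is symmetric positive definite; in particular it is invertible. -/
open Matrix

/-- Corollary 3.2 (main conclusion): if `A = U * tA * Uᵀ + D` is symmetric positive
definite, `U` has trivial kernel and `D` is symmetric positive definite, then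
`tA + (Uᵀ * D⁻¹ * U)⁻¹` is symmetric positive definite, and in particular invertible. -/
theorem stmt_8 (N K : ℕ)
    (A D : Matrix (Fin N) (Fin N) ℝ)
    (U : Matrix (Fin N) (Fin K) ℝ)
    (tA : Matrix (Fin K) (Fin K) ℝ)
    (hA : A.PosDef)
    (hD : D.PosDef)
    (hU : ∀ x : Fin K → ℝ, U.mulVec x = 0 → x = 0)
    (hfact : A = U * tA * Uᵀ + D) :
    (tA + (Uᵀ * D⁻¹ * U)⁻¹).PosDef ∧ IsUnit (tA + (Uᵀ * D⁻¹ * U)⁻¹).det := by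
  have hUinj : Function.Injective U.mulVec :=
    (injective_iff_map_eq_zero U.mulVecLin).mpr hU
  have hS : (Uᵀ * D⁻¹ * U).PosDef := by
    simpa only [conjTranspose_eq_transpose_of_trivial] using
      hD.inv.conjTranspose_mul_mul_same hUinj
  have hSunit : IsUnit (Uᵀ * D⁻¹ * U).det := (isUnit_iff_isUnit_det _).mp hS.isUnit
  have hDunit : IsUnit D.det := (isUnit_iff_isUnit_det _).mp hD.isUnit
  -- `W` is a right inverse of `Uᵀ`, and congruence by `W` turns `A` into the target matrix.
  set W := D⁻¹ * U * (Uᵀ * D⁻¹ * U)⁻¹ with hW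
  have hUW : Uᵀ * W = 1 := by
    rw [hW, ← Matrix.mul_assoc, ← Matrix.mul_assoc, mul_nonsing_inv _ hSunit]
  have hWU : Wᵀ * U = 1 := by
    rw [← transpose_transpose U, ← transpose_mul, hUW, transpose_one]
  have hDW : D * W = U * (Uᵀ * D⁻¹ * U)⁻¹ := by
    rw [hW, Matrix.mul_assoc D⁻¹, mul_nonsing_inv_cancel_left _ _ hDunit]
  have hWinj : Function.Injective W.mulVec := fun x y hxy => by
    simpa [mulVec_mulVec, hUW] using congrArg Uᵀ.mulVec hxy
  have hcongr : Wᵀ * A * W = tA + (Uᵀ * D⁻¹ * U)⁻¹ := by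
    calc Wᵀ * A * W = (Wᵀ * U) * tA * (Uᵀ * W) + Wᵀ * (D * W) := by
          rw [hfact]; simp only [Matrix.mul_add, Matrix.add_mul, Matrix.mul_assoc]
      _ = tA + (Uᵀ * D⁻¹ * U)⁻¹ := by
          rw [hDW, ← Matrix.mul_assoc Wᵀ, hWU, hUW]
          simp only [Matrix.one_mul, Matrix.mul_one]
  have hpos : (tA + (Uᵀ * D⁻¹ * U)⁻¹).PosDef := by
    rw [← hcongr]
    simpa only [conjTranspose_eq_transpose_of_trivial] using
      hA.conjTranspose_mul_mul_same hWinj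
  exact ⟨hpos, (isUnit_iff_isUnit_det _).mp hpos.isUnit⟩
end

section
/- Let A be an N×N symmetric positive definite real matrix admitting a factorization A = U * Ã * Uᵀ + D, where U is an N×K real matrix with trivial kernel (Ux = 0 implies x = 0), Ã is a K×K real matrix, and D is an N×N symmetric positive definite real matrix. Define D̂ = (UᵀD⁻¹U)⁻¹, E = D⁻¹ * U * D̂, and G = D⁻¹ − D⁻¹ * U * D̂ * Uᵀ * D⁻¹. Then A is invertible and A⁻¹ = E * (Ã + D̂)⁻¹ * Eᵀ + G; in particular, all inverses appearing in this formula exist. -/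
open Matrix

/-- The Woodbury-type inversion formula over a commutative ring, under invertibility of `A`, `D`
and `Uᵀ * D⁻¹ * U` and symmetry of `D`. -/
theorem inv_of_eq_mul_mul_transpose_add {m n R : Type*} [Fintype m] [DecidableEq m] [Fintype n]
    [DecidableEq n] [CommRing R] {A D : Matrix m m R} {U : Matrix m n R} {B : Matrix n n R}
    (hA : IsUnit A.det) (hD : IsUnit D.det) (hDs : Dᵀ = D) (hS : IsUnit (Uᵀ * D⁻¹ * U).det)
    (hfact : A = U * B * Uᵀ + D) :
    IsUnit (B + (Uᵀ * D⁻¹ * U)⁻¹).det ∧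
      A⁻¹ =
        (D⁻¹ * U * (Uᵀ * D⁻¹ * U)⁻¹) * (B + (Uᵀ * D⁻¹ * U)⁻¹)⁻¹ *
          (D⁻¹ * U * (Uᵀ * D⁻¹ * U)⁻¹)ᵀ +
        (D⁻¹ - D⁻¹ * U * (Uᵀ * D⁻¹ * U)⁻¹ * Uᵀ * D⁻¹) := by
  have hE : (D⁻¹ * U * (Uᵀ * D⁻¹ * U)⁻¹)ᵀ = (Uᵀ * D⁻¹ * U)⁻¹ * Uᵀ * D⁻¹ := by
    simp only [transpose_mul, transpose_nonsing_inv, transpose_transpose, hDs, Matrix.mul_assoc]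
  rw [hE]
  generalize hS_eq : Uᵀ * D⁻¹ * U = S at *
  have hADi : A * D⁻¹ = U * B * Uᵀ * D⁻¹ + 1 := by
    rw [hfact, Matrix.add_mul, mul_nonsing_inv D hD]
  have hAE : A * (D⁻¹ * U * S⁻¹) = U * (B + S⁻¹) := by
    calc A * (D⁻¹ * U * S⁻¹) = A * D⁻¹ * (U * S⁻¹) := by simp only [Matrix.mul_assoc]
      _ = U * B * ((Uᵀ * D⁻¹ * U) * S⁻¹) + U * S⁻¹ := by
        rw [hADi, Matrix.add_mul, Matrix.one_mul]; simp only [Matrix.mul_assoc]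
      _ = U * (B + S⁻¹) := by
        rw [hS_eq, mul_nonsing_inv S hS, Matrix.mul_one, Matrix.mul_add]
  have hT : IsUnit (B + S⁻¹).det := by
    refine (isUnit_iff_isUnit_det _).mp (IsUnit.of_mul_eq_one_right (Uᵀ * A⁻¹ * U) ?_)
    rw [Matrix.mul_assoc, ← hAE, Matrix.mul_assoc, nonsing_inv_mul_cancel_left _ _ hA,
      ← Matrix.mul_assoc, ← Matrix.mul_assoc, hS_eq, mul_nonsing_inv S hS]
  refine ⟨hT, inv_eq_right_inv ?_⟩
  calc A * (D⁻¹ * U * S⁻¹ * (B + S⁻¹)⁻¹ * (S⁻¹ * Uᵀ * D⁻¹) + (D⁻¹ - D⁻¹ * U * S⁻¹ * Uᵀ * D⁻¹))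
      = A * (D⁻¹ * U * S⁻¹) * (B + S⁻¹)⁻¹ * (S⁻¹ * Uᵀ * D⁻¹) + A * D⁻¹
          - A * (D⁻¹ * U * S⁻¹) * Uᵀ * D⁻¹ := by
        simp only [Matrix.mul_add, Matrix.mul_sub, Matrix.mul_assoc, add_sub_assoc]
    _ = 1 := by
        rw [hAE, hADi, Matrix.mul_assoc U, mul_nonsing_inv _ hT]
        simp only [Matrix.mul_add, Matrix.add_mul, Matrix.mul_one, Matrix.mul_assoc]
        abel

/-- Lemma 3.1 combined with Corollary 3.2: in the symmetric positive definite case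
(with `U = V`), the Woodbury-type inversion formula holds with no auxiliary
invertibility assumptions, and all the inverses appearing in it exist. -/
theorem stmt_9 (N K : ℕ)
    (A D : Matrix (Fin N) (Fin N) ℝ)
    (U : Matrix (Fin N) (Fin K) ℝ)
    (tA : Matrix (Fin K) (Fin K) ℝ)
    (hA : A.PosDef)
    (hD : D.PosDef)
    (hU : ∀ x : Fin K → ℝ, U.mulVec x = 0 → x = 0)
    (hfact : A = U * tA * Uᵀ + D) :
    IsUnit A.det ∧ IsUnit D.det ∧ IsUnit (Uᵀ * D⁻¹ * U).det ∧
      IsUnit (tA + (Uᵀ * D⁻¹ * U)⁻¹).det ∧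
      A⁻¹ =
        (D⁻¹ * U * (Uᵀ * D⁻¹ * U)⁻¹) *
          (tA + (Uᵀ * D⁻¹ * U)⁻¹)⁻¹ *
          (D⁻¹ * U * (Uᵀ * D⁻¹ * U)⁻¹)ᵀ +
        (D⁻¹ - D⁻¹ * U * (Uᵀ * D⁻¹ * U)⁻¹ * Uᵀ * D⁻¹) := by
  have hAu : IsUnit A.det := (isUnit_iff_isUnit_det A).mp hA.isUnit
  have hDu : IsUnit D.det := (isUnit_iff_isUnit_det D).mp hD.isUnit
  have hinj : Function.Injective U.mulVec :=
    (injective_iff_map_eq_zero U.mulVecLin).mpr hU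
  have hS : (Uᵀ * D⁻¹ * U).PosDef := by
    simpa using hD.inv.conjTranspose_mul_mul_same hinj
  have hSu : IsUnit (Uᵀ * D⁻¹ * U).det := (isUnit_iff_isUnit_det _).mp hS.isUnit
  have hDs : Dᵀ = D := by simpa using hD.isHermitian.eq
  exact ⟨hAu, hDu, hSu, inv_of_eq_mul_mul_transpose_add hAu hDu hDs hSu hfact⟩
end

section
/- Let B be an m×n real matrix of rank k ≥ 1. Then there exists a set J of k row indices of B and an m×k real matrix E such that: (1) B = E * B(J,:), where B(J,:) is the k×n submatrix of B formed by the rows indexed by J; (2) the k×k submatrix E(J,:) of E formed by the rows indexed by J is the k×k identity matrix; and (3) every entry of E has absolute value at most 1. -/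
open Matrix

namespace Matrix

/-- Every matrix factors through a linearly independent subfamily of its rows. -/
theorem exists_eq_mul_submatrix_of_rank_eq {K m n : Type*} [Field K] [Finite m] [Fintype n]
    {k : ℕ} (B : Matrix m n K) (hB : B.rank = k) :
    ∃ (J : Fin k → m) (C : Matrix m (Fin k) K),
      B = C * B.submatrix J id ∧ C.submatrix J id = 1 := by
  subst hB
  rw [rank_eq_finrank_span_row]
  obtain ⟨f, hf, hspan, hli⟩ := Submodule.exists_fun_fin_finrank_span_eq K (Set.range B.row)
  choose J hJ using hf
  have hmem (i : m) : ∃ c : Fin _ → K, ∑ j, c j • f j = B i := by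
    rw [← Submodule.mem_span_range_iff_exists_fun, hspan]
    exact Submodule.subset_span ⟨i, rfl⟩
  choose C hC using hmem
  obtain rfl : (B.submatrix J id).row = f := funext hJ
  have hfac : B = of C * B.submatrix J id := by
    ext i l
    rw [← hC i, mul_apply]
    simp
  refine ⟨J, of C, hfac, ?_⟩
  refine funext fun i => vecMul_injective_iff.mpr hli ?_
  ext l
  have h := congrFun₂ hfac (J i) l
  simpa [mul_apply, vecMul, dotProduct, one_apply] using h.symm

/-- A coefficient matrix with an invertible square row submatrix has one with determinant of
maximal absolute value. -/
theorem exists_submatrix_det_ne_zero_forall_abs_det_le {m κ : Type*} [Finite m] [Fintype κ]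
    [DecidableEq κ] (C : Matrix m κ ℝ) (J₀ : κ → m) (h₀ : (C.submatrix J₀ id).det ≠ 0) :
    ∃ J : κ → m, (C.submatrix J id).det ≠ 0 ∧
      ∀ J' : κ → m, |(C.submatrix J' id).det| ≤ |(C.submatrix J id).det| := by
  have : Nonempty (κ → m) := ⟨J₀⟩
  obtain ⟨J, hJ⟩ := Finite.exists_max fun J : κ → m => |(C.submatrix J id).det|
  exact ⟨J, abs_pos.mp ((abs_pos.mpr h₀).trans_le (hJ J₀)), hJ⟩

/-- If a row submatrix of maximal absolute determinant is the identity, then all entries are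
bounded by one. -/
theorem abs_apply_le_one_of_submatrix_eq_one {m κ : Type*} [Fintype κ] [DecidableEq κ]
    (E : Matrix m κ ℝ) (J : κ → m) (hJ : E.submatrix J id = 1)
    (hmax : ∀ J' : κ → m, |(E.submatrix J' id).det| ≤ 1) (i : m) (j : κ) : |E i j| ≤ 1 := by
  have h : E.submatrix (Function.update J j i) id = (1 : Matrix κ κ ℝ).updateRow j (E i) := by
    ext a b
    rw [← hJ]
    by_cases hab : a = j <;> simp [updateRow_apply, hab]
  have hdet : (E.submatrix (Function.update J j i) id).det = E i j := by
    rw [h, ← cramer_transpose_apply, transpose_one, cramer_one, Module.End.one_apply]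
  exact hdet ▸ hmax _

end Matrix

/-- Existence of the (row) interpolatory decomposition (Section 2.2): a rank-`k`
matrix `B` (with `k ≥ 1`) can be written as `B = E * B(J, :)` where `J` picks `k`
rows of `B`, `E(J, :)` is the `k × k` identity, and every entry of `E` is bounded
by `1` in absolute value. -/
theorem stmt_10 (m n k : ℕ) (hk : 1 ≤ k)
    (B : Matrix (Fin m) (Fin n) ℝ)
    (hrank : B.rank = k) :
    ∃ J : Fin k → Fin m, Function.Injective J ∧
      ∃ E : Matrix (Fin m) (Fin k) ℝ,
        B = E * B.submatrix J id ∧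
        E.submatrix J id = 1 ∧
        ∀ i j, |E i j| ≤ 1 := by
  obtain ⟨J₀, C, hfac, hC⟩ := B.exists_eq_mul_submatrix_of_rank_eq hrank
  obtain ⟨J, hdet, hmax⟩ :=
    C.exists_submatrix_det_ne_zero_forall_abs_det_le J₀ (by simp [hC])
  have hsub (J' : Fin k → Fin m) : (C * (C.submatrix J id)⁻¹).submatrix J' id =
      C.submatrix J' id * (C.submatrix J id)⁻¹ := rfl
  have hJ : (C * (C.submatrix J id)⁻¹).submatrix J id = 1 := by
    rw [hsub, mul_nonsing_inv _ hdet.isUnit]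
  have hBJ : B.submatrix J id = C.submatrix J id * B.submatrix J₀ id :=
    congrArg (fun M => M.submatrix J id) hfac
  refine ⟨J, fun a b hab => ?_, C * (C.submatrix J id)⁻¹, ?_, hJ, ?_⟩
  · by_contra hne
    have ha := congrFun₂ hJ a a
    have hb := congrFun₂ hJ b a
    rw [submatrix_apply, hab] at ha
    rw [submatrix_apply, ha] at hb
    simp [one_apply, Ne.symm hne] at hb
  · rw [hBJ, Matrix.mul_assoc, nonsing_inv_mul_cancel_left _ _ hdet.isUnit, ← hfac]
  · refine abs_apply_le_one_of_submatrix_eq_one _ J hJ fun J' => ?_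
    rw [hsub, det_mul, det_nonsing_inv, Ring.inverse_eq_inv', ← div_eq_mul_inv, abs_div]
    exact div_le_one_of_le₀ (hmax J') (abs_nonneg _)
end
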